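/- arXiv:2512.19156 — 4 statements merged into one kernel-verified Lean document; each statement's English description precedes it below -/
import Mathlib

section
/- Let k ∈ ℤ and let t, t' be tapes with t(k) ≠ t'(k). If k ≥ 0 and t(j) = t'(j) for all j ∈ {−k, …, k−1}, then |e(t) − e(t')| ≥ 3^{-(2k+1)}. If k ≤ −1 and t(j) = t'(j) for all j ∈ {k+1, …, −k−1}, then |e(t) − e(t')| ≥ 3^{2k}. -/
/-- A tape is a function `t : ℤ → {0,1}`. Its encoding is the real number
`e(t) := 2·∑_{n=0}^∞ t(n)·3^{-(2n+1)} + 2·∑_{n=1}^∞ t(−n)·3^{-2n}`. -/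
noncomputable def tapeEnc (t : ℤ → Fin 2) : ℝ :=
  2 * ∑' n : ℕ, ((t (n : ℤ) : ℕ) : ℝ) * (3 : ℝ)⁻¹ ^ (2 * n + 1)
    + 2 * ∑' n : ℕ, ((t (-((n : ℤ) + 1)) : ℕ) : ℝ) * (3 : ℝ)⁻¹ ^ (2 * (n + 1))

/-- The tape cell whose symbol occupies ternary digit `m + 1` of the encoding. -/
def tapeCell (m : ℕ) : ℤ :=
  if m % 2 = 0 then ((m / 2 : ℕ) : ℤ) else -(((m / 2 : ℕ) : ℤ) + 1)

lemma tapeCell_two_mul (n : ℕ) : tapeCell (2 * n) = n := by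
  simp [tapeCell]

lemma tapeCell_two_mul_add_one (n : ℕ) : tapeCell (2 * n + 1) = -((n : ℤ) + 1) := by
  unfold tapeCell
  split_ifs <;> omega

lemma summable_mul_inv_three_pow {a : ℕ → ℝ} (ha : ∀ m, |a m| ≤ 1) {e : ℕ → ℕ}
    (he : Function.Injective e) : Summable fun m => a m * (3 : ℝ)⁻¹ ^ e m := by
  have hg : Summable fun m => (3 : ℝ)⁻¹ ^ e m :=
    (summable_geometric_of_lt_one (by norm_num) (by norm_num)).comp_injective he
  refine hg.of_norm_bounded fun m => ?_
  rw [Real.norm_eq_abs, abs_mul, abs_of_pos (by positivity : (0 : ℝ) < 3⁻¹ ^ e m)]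
  exact mul_le_of_le_one_left (by positivity) (ha m)

lemma abs_symbol_le_one (x : Fin 2) : |((x : ℕ) : ℝ)| ≤ 1 := by
  fin_cases x <;> simp

lemma tapeEnc_eq_tsum (t : ℤ → Fin 2) :
    tapeEnc t = 2 * ∑' m : ℕ, ((t (tapeCell m) : ℕ) : ℝ) * (3 : ℝ)⁻¹ ^ (m + 1) := by
  have hs (e : ℕ → ℕ) (c : ℕ → ℤ) (he : Function.Injective e) :
      Summable fun m => ((t (c m) : ℕ) : ℝ) * (3 : ℝ)⁻¹ ^ e m :=
    summable_mul_inv_three_pow (fun m => abs_symbol_le_one _) he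
  rw [← tsum_even_add_odd
      (f := fun m : ℕ => ((t (tapeCell m) : ℕ) : ℝ) * (3 : ℝ)⁻¹ ^ (m + 1))
      (hs (fun m => 2 * m + 1) (fun m => tapeCell (2 * m)) fun a b h => by grind)
      (hs (fun m => 2 * m + 1 + 1) (fun m => tapeCell (2 * m + 1)) fun a b h => by grind)]
  simp only [tapeCell_two_mul, tapeCell_two_mul_add_one, tapeEnc]
  ring_nf

/-- A signed ternary expansion with digits in `[-2, 2]` is bounded away from zero by its leading
digit, when that digit is `±2`. -/
lemma inv_three_pow_le_abs_tsum {a : ℕ → ℝ} (ha : ∀ m, |a m| ≤ 1) {N : ℕ}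
    (hlt : ∀ m < N, a m = 0) (hN : |a N| = 1) :
    (3 : ℝ)⁻¹ ^ (N + 1) ≤ |2 * ∑' m, a m * (3 : ℝ)⁻¹ ^ (m + 1)| := by
  have hs := summable_mul_inv_three_pow ha (add_left_injective 1)
  have htail : |∑' m, a (m + (N + 1)) * (3 : ℝ)⁻¹ ^ (m + (N + 1) + 1)|
      ≤ (3 : ℝ)⁻¹ ^ (N + 1) / 2 := by
    have hg : HasSum (fun m : ℕ => (3 : ℝ)⁻¹ ^ (N + 2) * (3 : ℝ)⁻¹ ^ m)
        ((3 : ℝ)⁻¹ ^ (N + 1) / 2) := by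
      have hsum : (3 : ℝ)⁻¹ ^ (N + 2) * (1 - 3⁻¹)⁻¹ = 3⁻¹ ^ (N + 1) / 2 := by
        rw [pow_succ _ (N + 1)]
        norm_num
        ring
      rw [← hsum]
      exact (hasSum_geometric_of_lt_one (by norm_num) (by norm_num)).mul_left _
    rw [← Real.norm_eq_abs]
    refine tsum_of_norm_bounded hg fun m => ?_
    rw [Real.norm_eq_abs, abs_mul, abs_of_pos (by positivity : (0 : ℝ) < 3⁻¹ ^ _), ← pow_add,
      show m + (N + 1) + 1 = N + 2 + m by ring]
    exact mul_le_of_le_one_left (by positivity) (ha _)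
  rw [← hs.sum_add_tsum_nat_add (N + 1), Finset.sum_range_succ,
    Finset.sum_eq_zero fun m hm => by rw [hlt m (Finset.mem_range.1 hm), zero_mul], zero_add,
    abs_mul, abs_two]
  have hlead : |a N * (3 : ℝ)⁻¹ ^ (N + 1)| = (3 : ℝ)⁻¹ ^ (N + 1) := by
    rw [abs_mul, hN, one_mul, abs_of_pos (by positivity)]
  have := abs_sub_abs_le_abs_add (a N * (3 : ℝ)⁻¹ ^ (N + 1))
    (∑' m, a (m + (N + 1)) * (3 : ℝ)⁻¹ ^ (m + (N + 1) + 1))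
  linarith

lemma inv_three_pow_le_abs_tapeEnc_sub {t t' : ℤ → Fin 2} {N : ℕ}
    (hlt : ∀ m < N, t (tapeCell m) = t' (tapeCell m))
    (hN : t (tapeCell N) ≠ t' (tapeCell N)) :
    (3 : ℝ)⁻¹ ^ (N + 1) ≤ |tapeEnc t - tapeEnc t'| := by
  have hs (u : ℤ → Fin 2) :=
    summable_mul_inv_three_pow (fun m => abs_symbol_le_one (u (tapeCell m)))
      (add_left_injective 1)
  rw [tapeEnc_eq_tsum, tapeEnc_eq_tsum, ← mul_sub, ← (hs t).tsum_sub (hs t')]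
  simp only [← sub_mul]
  refine inv_three_pow_le_abs_tsum
    (a := fun m => ((t (tapeCell m) : ℕ) : ℝ) - (t' (tapeCell m) : ℕ))
    (fun m => ?_) (fun m hm => by simp [hlt m hm]) ?_
  · generalize t (tapeCell m) = x
    generalize t' (tapeCell m) = y
    fin_cases x <;> fin_cases y <;> simp
  · generalize t (tapeCell N) = x at hN ⊢
    generalize t' (tapeCell N) = y at hN ⊢
    fin_cases x <;> fin_cases y <;> simp_all

/-- Let `k ∈ ℤ` and let `t, t'` be tapes with `t(k) ≠ t'(k)`. If `k ≥ 0` and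
`t(j) = t'(j)` for all `j ∈ {−k, …, k−1}`, then `|e(t) − e(t')| ≥ 3^{-(2k+1)}`.
If `k ≤ −1` and `t(j) = t'(j)` for all `j ∈ {k+1, …, −k−1}`, then
`|e(t) − e(t')| ≥ 3^{2k}`. -/
theorem tapeEnc_separation (k : ℤ) (t t' : ℤ → Fin 2) (h : t k ≠ t' k) :
    (0 ≤ k → (∀ j : ℤ, -k ≤ j → j ≤ k - 1 → t j = t' j) →
      (3 : ℝ) ^ (-(2 * k + 1)) ≤ |tapeEnc t - tapeEnc t'|) ∧
    (k ≤ -1 → (∀ j : ℤ, k + 1 ≤ j → j ≤ -k - 1 → t j = t' j) →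
      (3 : ℝ) ^ (2 * k) ≤ |tapeEnc t - tapeEnc t'|) := by
  constructor
  · intro hk heq
    obtain ⟨n, rfl⟩ := Int.eq_ofNat_of_zero_le hk
    have hle := inv_three_pow_le_abs_tapeEnc_sub (t := t) (t' := t') (N := 2 * n)
      (fun m hm => heq _ (by unfold tapeCell; split_ifs <;> omega)
        (by unfold tapeCell; split_ifs <;> omega)) (by rwa [tapeCell_two_mul])
    rw [zpow_neg, ← inv_zpow]
    exact_mod_cast hle
  · intro hk heq
    obtain ⟨n, rfl⟩ : ∃ n : ℕ, k = -((n : ℤ) + 1) := ⟨(-k - 1).toNat, by omega⟩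
    have hle := inv_three_pow_le_abs_tapeEnc_sub (t := t) (t' := t') (N := 2 * n + 1)
      (fun m hm => heq _ (by unfold tapeCell; split_ifs <;> omega)
        (by unfold tapeCell; split_ifs <;> omega)) (by rwa [tapeCell_two_mul_add_one])
    rw [mul_neg, zpow_neg, ← inv_zpow]
    exact_mod_cast hle
end

section
/- The computation-state encoding (t,k) ↦ τ_k(e(t)) is injective: if t, t' are tapes and k, k' ∈ ℤ satisfy τ_k(e(t)) = τ_{k'}(e(t')), then k = k' and t = t'. -/
/-- For `k ∈ ℤ`, the affine map `τ_k : ℝ → ℝ`, given by `τ_k(x) := 3^{-(1−k)}·(1+x)`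
if `k < 0` and `τ_k(x) := 1 + 3^{-(1+k)}·(x − 2)` if `k ≥ 0`. -/
noncomputable def tau (k : ℤ) (x : ℝ) : ℝ :=
  if k < 0 then (3 : ℝ) ^ (-(1 - k)) * (1 + x) else 1 + (3 : ℝ) ^ (-(1 + k)) * (x - 2)

/-- The ternary digits, all in `{0, 2}`, of `tapeEnc t`: the cells `0, -1, 1, -2, 2, …` are read
in this order. -/
def tapeDigits (t : ℤ → Fin 2) (n : ℕ) : Fin 3 :=
  if t (Equiv.intEquivNat.symm n) = 0 then 0 else 2

theorem tapeDigits_ne_one (t : ℤ → Fin 2) (n : ℕ) : tapeDigits t n ≠ 1 := by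
  unfold tapeDigits
  split_ifs <;> decide

theorem tapeDigits_injective : Function.Injective tapeDigits := by
  intro t t' h
  funext z
  have hz := congrFun h (Equiv.intEquivNat z)
  simp only [tapeDigits, Equiv.symm_apply_apply] at hz
  generalize t z = a at hz ⊢
  generalize t' z = b at hz ⊢
  revert a b
  decide

theorem coe_tapeDigits (t : ℤ → Fin 2) (n : ℕ) :
    ((tapeDigits t n : ℕ) : ℝ) = 2 * ((t (Equiv.intEquivNat.symm n) : ℕ) : ℝ) := by
  unfold tapeDigits
  generalize t (Equiv.intEquivNat.symm n) = a
  fin_cases a <;> simp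

theorem intEquivNat_symm_two_mul (n : ℕ) : Equiv.intEquivNat.symm (2 * n) = (n : ℤ) := by
  rw [Equiv.symm_apply_eq]
  rfl

theorem intEquivNat_symm_two_mul_add_one (n : ℕ) :
    Equiv.intEquivNat.symm (2 * n + 1) = -((n : ℤ) + 1) := by
  rw [Equiv.symm_apply_eq, ← Int.negSucc_eq]
  simp [Equiv.intEquivNat, Equiv.intEquivNatSumNat]

theorem tapeEnc_eq_ofDigits (t : ℤ → Fin 2) : tapeEnc t = Real.ofDigits (tapeDigits t) := by
  have hs : Summable (Real.ofDigitsTerm (tapeDigits t)) := Real.summable_ofDigitsTerm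
  rw [Real.ofDigits, ← tsum_even_add_odd
    (hs.comp_injective (i := fun n ↦ 2 * n) fun a b h ↦ by simpa using h)
    (hs.comp_injective (i := fun n ↦ 2 * n + 1) fun a b h ↦ by simpa using h),
    tapeEnc, ← tsum_mul_left, ← tsum_mul_left]
  congr 1 <;> refine tsum_congr fun n ↦ ?_
  · rw [Real.ofDigitsTerm, coe_tapeDigits, intEquivNat_symm_two_mul, mul_assoc]
    simp
  · rw [Real.ofDigitsTerm, coe_tapeDigits, intEquivNat_symm_two_mul_add_one, mul_assoc]
    simp [mul_add, add_assoc]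

theorem tapeEnc_nonneg (t : ℤ → Fin 2) : 0 ≤ tapeEnc t :=
  tapeEnc_eq_ofDigits t ▸ Real.ofDigits_nonneg _

theorem tapeEnc_le_one (t : ℤ → Fin 2) : tapeEnc t ≤ 1 :=
  tapeEnc_eq_ofDigits t ▸ Real.ofDigits_le_one _

theorem tapeEnc_injective : Function.Injective tapeEnc := by
  intro t t' h
  rw [tapeEnc_eq_ofDigits, tapeEnc_eq_ofDigits] at h
  exact tapeDigits_injective
    (ofDigits_zero_two_sequence_unique (tapeDigits_ne_one t) (tapeDigits_ne_one t') h)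

theorem le_of_three_zpow_mul_eq {m n : ℤ} {a b : ℝ} (ha : a ≤ 2) (hb : 1 ≤ b)
    (h : (3 : ℝ) ^ m * a = 3 ^ n * b) : n ≤ m := by
  by_contra! hmn
  have hm : (0 : ℝ) < 3 ^ m := by positivity
  have hle : (3 : ℝ) ^ (m + 1) ≤ 3 ^ n := zpow_le_zpow_right₀ (by norm_num) hmn
  rw [zpow_add_one₀ (by norm_num)] at hle
  nlinarith

/-- The scaled intervals `3 ^ m * [1, 2]`, `m ∈ ℤ`, are pairwise disjoint. -/
theorem three_zpow_mul_inj {m n : ℤ} {a b : ℝ} (ha : a ∈ Set.Icc 1 2) (hb : b ∈ Set.Icc 1 2)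
    (h : (3 : ℝ) ^ m * a = 3 ^ n * b) : m = n ∧ a = b := by
  obtain rfl : m = n :=
    le_antisymm (le_of_three_zpow_mul_eq hb.2 ha.1 h.symm) (le_of_three_zpow_mul_eq ha.2 hb.1 h)
  exact ⟨rfl, mul_left_cancel₀ (by positivity) h⟩

theorem tau_lt_tau_of_neg_of_nonneg {k k' : ℤ} (hk : k < 0) (hk' : 0 ≤ k') {x y : ℝ}
    (hx : x ∈ Set.Icc 0 1) (hy : y ∈ Set.Icc 0 1) : tau k x < tau k' y := by
  obtain ⟨hx0, hx1⟩ := hx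
  obtain ⟨hy0, hy1⟩ := hy
  rw [tau, if_pos hk, tau, if_neg hk'.not_gt]
  have h1 : (3 : ℝ) ^ (-(1 - k)) ≤ 3 ^ (-2 : ℤ) := zpow_le_zpow_right₀ (by norm_num) (by omega)
  have h2 : (3 : ℝ) ^ (-(1 + k')) ≤ 3 ^ (-1 : ℤ) := zpow_le_zpow_right₀ (by norm_num) (by omega)
  have h3 : (0 : ℝ) < 3 ^ (-(1 - k)) := by positivity
  have h4 : (0 : ℝ) < 3 ^ (-(1 + k')) := by positivity
  rw [show (3 : ℝ) ^ (-2 : ℤ) = 1 / 9 by norm_num] at h1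
  rw [show (3 : ℝ) ^ (-1 : ℤ) = 1 / 3 by norm_num] at h2
  nlinarith

/-- On `[0, 1]` the maps `tau k` are injective and have pairwise disjoint ranges. -/
theorem tau_inj {k k' : ℤ} {x y : ℝ} (hx : x ∈ Set.Icc 0 1) (hy : y ∈ Set.Icc 0 1)
    (h : tau k x = tau k' y) : k = k' ∧ x = y := by
  rcases lt_or_ge k 0 with hk | hk <;> rcases lt_or_ge k' 0 with hk' | hk'
  · rw [tau, if_pos hk, tau, if_pos hk'] at h
    have := three_zpow_mul_inj ⟨by linarith [hx.1], by linarith [hx.2]⟩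
      ⟨by linarith [hy.1], by linarith [hy.2]⟩ h
    exact ⟨by omega, by linarith⟩
  · exact absurd h (tau_lt_tau_of_neg_of_nonneg hk hk' hx hy).ne
  · exact absurd h (tau_lt_tau_of_neg_of_nonneg hk' hk hy hx).ne'
  · rw [tau, if_neg hk.not_gt, tau, if_neg hk'.not_gt] at h
    have h' : (3 : ℝ) ^ (-(1 + k)) * (2 - x) = 3 ^ (-(1 + k')) * (2 - y) := by linarith
    have := three_zpow_mul_inj ⟨by linarith [hx.2], by linarith [hx.1]⟩
      ⟨by linarith [hy.2], by linarith [hy.1]⟩ h'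
    exact ⟨by omega, by linarith⟩

/-- The computation-state encoding `(t,k) ↦ τ_k(e(t))` is injective: if `t, t'` are
tapes and `k, k' ∈ ℤ` satisfy `τ_k(e(t)) = τ_{k'}(e(t'))`, then `k = k'` and `t = t'`. -/
theorem stateEnc_injective (t t' : ℤ → Fin 2) (k k' : ℤ)
    (h : tau k (tapeEnc t) = tau k' (tapeEnc t')) : k = k' ∧ t = t' := by
  have hmem (s : ℤ → Fin 2) : tapeEnc s ∈ Set.Icc 0 1 := ⟨tapeEnc_nonneg s, tapeEnc_le_one s⟩
  obtain ⟨hk, ht⟩ := tau_inj (hmem t) (hmem t') h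
  exact ⟨hk, tapeEnc_injective ht⟩
end

section
/- Let k ≥ 0 be an integer and let t, t' be tapes with t(k) = 0, t'(k) = 1, and t(j) = t'(j) for all j ≠ k. Then τ_k(e(t')) = τ_k(e(t)) + 2·3^{-(3k+2)}. That is, rewriting the symbol at head position k from 0 to 1 displaces the encoded computation state by exactly 2·3^{-(3k+2)}. -/
/-- The series of ternary digits at the odd positions of a `{0,1}`-valued sequence converges. -/
theorem summable_digits_odd (d : ℕ → Fin 2) :
    Summable fun n : ℕ => ((d n : ℕ) : ℝ) * (3 : ℝ)⁻¹ ^ (2 * n + 1) := by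
  have hgeom : Summable fun n : ℕ => ((3 : ℝ)⁻¹ ^ 2) ^ n * (3 : ℝ)⁻¹ :=
    (summable_geometric_of_lt_one (by norm_num) (by norm_num)).mul_right _
  refine hgeom.of_nonneg_of_le (fun n => by positivity) fun n => ?_
  have hd : ((d n : ℕ) : ℝ) ≤ 1 := by exact_mod_cast Nat.le_of_lt_succ (d n).isLt
  rw [← pow_mul, ← pow_succ]
  exact mul_le_of_le_one_left (by positivity) hd

/-- Changing the symbol at a nonnegative position `k` from `0` to `1` increases the encoding of a
tape by `2·3^{-(2k+1)}`. -/
theorem tapeEnc_rewrite (k : ℕ) (t t' : ℤ → Fin 2) (ht : t k = 0) (ht' : t' k = 1)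
    (hj : ∀ j : ℤ, j ≠ k → t j = t' j) :
    tapeEnc t' = tapeEnc t + 2 * (3 : ℝ)⁻¹ ^ (2 * k + 1) := by
  have hnonneg : ∑' n : ℕ, ((t' (n : ℤ) : ℕ) : ℝ) * (3 : ℝ)⁻¹ ^ (2 * n + 1)
      = ∑' n : ℕ, ((t (n : ℤ) : ℕ) : ℝ) * (3 : ℝ)⁻¹ ^ (2 * n + 1) + (3 : ℝ)⁻¹ ^ (2 * k + 1) := by
    refine HasSum.tsum_eq ?_
    convert (summable_digits_odd fun n => t n).hasSum.add
      (hasSum_ite_eq k ((3 : ℝ)⁻¹ ^ (2 * k + 1))) using 2 with n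
    by_cases hn : n = k
    · subst hn
      simp [ht, ht']
    · simp [hn, hj n (by exact_mod_cast hn)]
  have hneg (n : ℕ) : t' (-((n : ℤ) + 1)) = t (-((n : ℤ) + 1)) := (hj _ (by omega)).symm
  simp only [tapeEnc, hnonneg, hneg]
  ring

/-- Let `k ≥ 0` be an integer and let `t, t'` be tapes with `t(k) = 0`, `t'(k) = 1`,
and `t(j) = t'(j)` for all `j ≠ k`. Then `τ_k(e(t')) = τ_k(e(t)) + 2·3^{-(3k+2)}`:
rewriting the symbol at head position `k` from `0` to `1` displaces the encoded
computation state by exactly `2·3^{-(3k+2)}`. -/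
theorem rewrite_displacement (k : ℤ) (hk : 0 ≤ k) (t t' : ℤ → Fin 2)
    (ht : t k = 0) (ht' : t' k = 1) (hj : ∀ j : ℤ, j ≠ k → t j = t' j) :
    tau k (tapeEnc t') = tau k (tapeEnc t) + 2 * (3 : ℝ) ^ (-(3 * k + 2)) := by
  lift k to ℕ using hk
  have hpow : (3 : ℝ) ^ (-(3 * (k : ℤ) + 2))
      = (3 : ℝ) ^ (-(1 + (k : ℤ))) * (3 : ℝ)⁻¹ ^ (2 * k + 1) := by
    rw [← zpow_natCast, inv_zpow', ← zpow_add₀ three_ne_zero]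
    congr 1
    push_cast
    ring
  rw [tapeEnc_rewrite k t t' ht ht' hj, hpow]
  simp only [tau, not_lt.mpr (Int.natCast_nonneg k), if_false]
  ring
end

section
/- Let f, g > 0 and u ∈ ℝ. Then the point q := (g/f)·p_f(u) lies on the confocal parabola P_g; in fact q = p_g((g/f)·u). Moreover, the specular reflection of the direction −p_f(u) at q across the tangent direction d_g((g/f)·u) of P_g is a positive scalar multiple of (0,−1). Consequently, the composition of the two specular reflections — first at p_f(u) on P_f, then at q on P_g — maps the downward vertical direction (0,−1) to a positive multiple of (0,−1), while the abscissa changes from u to (g/f)·u; that is, confocal parabolic mirrors realize the linear map u ↦ (g/f)·u on vertical rays. -/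
/-- The specular reflection of a vector `v ∈ ℝ²` across a line with direction vector
`d ≠ 0`: `R_d(v) := 2·(⟨v,d⟩/⟨d,d⟩)·d − v`. -/
noncomputable def reflect2 (d v : ℝ × ℝ) : ℝ × ℝ :=
  (2 * ((v.1 * d.1 + v.2 * d.2) / (d.1 * d.1 + d.2 * d.2))) • d - v

/-- The point `p_f(u) = (u, u²/(4f) − f)` of the parabola `P_f` with focus at the
origin and vertical axis. -/
noncomputable def pf (f u : ℝ) : ℝ × ℝ := (u, u ^ 2 / (4 * f) - f)

/-- The tangent direction `d_f(u) = (1, u/(2f))` of the parabola `P_f` at `p_f(u)`. -/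
noncomputable def df (f u : ℝ) : ℝ × ℝ := (1, u / (2 * f))

theorem df_div_mul {f g : ℝ} (hg : g ≠ 0) (u : ℝ) : df g ((g / f) * u) = df f u := by
  simp only [df, Prod.mk.injEq, true_and]
  field_simp

theorem reflect2_df_reflect2_df (f u : ℝ) (v : ℝ × ℝ) :
    reflect2 (df f u) (reflect2 (df f u) v) = v := by
  have h : 1 + u / (2 * f) * (u / (2 * f)) ≠ 0 :=
    (add_pos_of_pos_of_nonneg one_pos (mul_self_nonneg _)).ne'
  simp only [df, reflect2]
  generalize u / (2 * f) = t at h ⊢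
  have h' : 1 + t ^ 2 ≠ 0 := by rwa [sq]
  ext <;> simp <;> field_simp <;> ring

theorem reflect2_df_neg_pf {f : ℝ} (hf : f ≠ 0) (u : ℝ) :
    reflect2 (df f u) (-pf f u) = (f * (1 + (u / (2 * f)) ^ 2)) • ((0, -1) : ℝ × ℝ) := by
  obtain ⟨t, rfl⟩ : ∃ t, u = 2 * f * t := ⟨u / (2 * f), by field_simp⟩
  have ht : 2 * f * t / (2 * f) = t := by field_simp
  have hp : (2 * f * t) ^ 2 / (4 * f) = f * t ^ 2 := by field_simp; ring
  have h : 1 + t ^ 2 ≠ 0 := by positivity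
  simp only [df, pf, reflect2, ht, hp]
  ext <;> simp <;> field_simp <;> ring

/-- Let `f, g > 0` and `u ∈ ℝ`. Then the point `q := (g/f)·p_f(u)` lies on the confocal
parabola `P_g`; in fact `q = p_g((g/f)·u)`. Moreover, the specular reflection of the
direction `−p_f(u)` at `q` across the tangent direction `d_g((g/f)·u)` of `P_g` is a
positive scalar multiple of `(0,−1)`. Consequently, the composition of the two
specular reflections — first at `p_f(u)` on `P_f`, then at `q` on `P_g` — maps the
downward vertical direction `(0,−1)` to a positive multiple of `(0,−1)`, while the
abscissa changes from `u` to `(g/f)·u`: confocal parabolic mirrors realize the linear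
map `u ↦ (g/f)·u` on vertical rays. -/
theorem confocal_parabolas_scale (f g : ℝ) (hf : 0 < f) (hg : 0 < g) (u : ℝ) :
    (g / f) • pf f u = pf g ((g / f) * u) ∧
    (∃ c : ℝ, 0 < c ∧
      reflect2 (df g ((g / f) * u)) (-pf f u) = c • ((0, -1) : ℝ × ℝ)) ∧
    ∃ c : ℝ, 0 < c ∧
      reflect2 (df g ((g / f) * u)) (reflect2 (df f u) ((0, -1) : ℝ × ℝ)) =
        c • ((0, -1) : ℝ × ℝ) := by
  rw [df_div_mul hg.ne']
  refine ⟨?_, ⟨_, by positivity, reflect2_df_neg_pf hf.ne' u⟩, 1, one_pos, ?_⟩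
  · simp only [pf, Prod.smul_mk, smul_eq_mul, Prod.mk.injEq, true_and]
    field_simp
  · rw [reflect2_df_reflect2_df, one_smul]
end
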